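/- arXiv:2010.15811 — 2 statements merged into one kernel-verified Lean document; each statement's English description precedes it below -/
import Mathlib

section
/- Let γ ∈ SF⁺ with q̄ = q̄(γ). For every t ∈ [0,q̄], the function x ↦ Φ_γ(t,x) is differentiable and its derivative satisfies ∂ₓΦ_γ(t,x) ≥ max(0, (κ−x)/λ(t)) for all x ∈ ℝ; in particular ∂ₓΦ_γ(t,x) > 0 for all (t,x) ∈ [0,q̄] × ℝ. (Lower bound in Proposition 4.1, Eq. (4.8).) -/
open MeasureTheory ProbabilityTheory

/-- The standard Gaussian measure on `ℝ`. -/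
noncomputable def stdGauss : Measure ℝ := gaussianReal 0 1

/-- The Gaussian tail function `𝒩(v) = P(Z ≥ v)`. -/
noncomputable def gaussTail (v : ℝ) : ℝ := (stdGauss (Set.Ici v)).toReal

/-- A functional order parameter in `SF⁺`: a non-decreasing step function
`γ = Σ_{i=0}^n m_i · 1_{[q_i, q_{i+1})}` with `0 = q_0 < q_1 < ⋯ < q_{n+1} = 1` and
`0 = m_0 ≤ m_1 ≤ ⋯ ≤ m_n = 1`. -/
structure StepFn where
  n : ℕ
  q : ℕ → ℝ
  m : ℕ → ℝ
  q_zero : q 0 = 0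
  q_last : q (n + 1) = 1
  q_lt : ∀ i ≤ n, q i < q (i + 1)
  m_zero : m 0 = 0
  m_last : m n = 1
  m_mono : ∀ i < n, m i ≤ m (i + 1)

namespace StepFn

/-- The right end `q̄(γ) = q_n` of the support of `γ`. -/
noncomputable def qbar (γ : StepFn) : ℝ := γ.q γ.n

open Classical in
/-- `γ` as a function: `γ(s) = m_i` for `s ∈ [q_i, q_{i+1})`, and `0` outside `[0,1)`. -/
noncomputable def toFun (γ : StepFn) (s : ℝ) : ℝ :=
  if s ∈ Set.Ico (0 : ℝ) 1 then γ.m (Nat.findGreatest (fun i => γ.q i ≤ s) γ.n) else 0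

end StepFn

/-- One Cole–Hopf step: given a boundary value `g` at the right end of an interval,
spread `s` and parameter `m`, produce the value at distance `s` from the right end. -/
noncomputable def coleHopf (m s : ℝ) (g : ℝ → ℝ) (x : ℝ) : ℝ :=
  if 0 < m then (1 / m) * Real.log (∫ z, Real.exp (m * g (x + Real.sqrt s * z)) ∂stdGauss)
  else ∫ z, g (x + Real.sqrt s * z) ∂stdGauss

namespace StepFn

/-- `PhiAux γ κ j` is the solution `Φ_γ` on the interval `[q_{n-j}, q_{n-j+1})`,
built recursively downward from the terminal condition on `[q_n, 1)`. -/
noncomputable def PhiAux (γ : StepFn) (κ : ℝ) : ℕ → ℝ → ℝ → ℝ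
  | 0 => fun t x => Real.log (gaussTail ((κ - x) / Real.sqrt (1 - t)))
  | j + 1 => fun t x =>
      coleHopf (γ.m (γ.n - (j + 1))) (γ.q (γ.n - j) - t) (γ.PhiAux κ j (γ.q (γ.n - j))) x

open Classical in
/-- The solution `Φ_γ(t,x)` of the Parisi PDE for the step function `γ`:
for `t ∈ [q_i, q_{i+1})` it is given by `PhiAux γ κ (n - i)`. -/
noncomputable def Phi (γ : StepFn) (κ : ℝ) (t x : ℝ) : ℝ :=
  γ.PhiAux κ (γ.n - Nat.findGreatest (fun i => γ.q i ≤ t) γ.n) t x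

end StepFn

/-- Measurable functions growing at most like `exp |x|`. -/
def ExpBounded (f : ℝ → ℝ) : Prop := Measurable f ∧ ∃ C, ∀ x, |f x| ≤ C * Real.exp |x|

instance : IsProbabilityMeasure stdGauss := by unfold stdGauss; infer_instance

instance : stdGauss.IsOpenPosMeasure :=
  (gaussianReal_absolutelyContinuous' 0 one_ne_zero).isOpenPosMeasure

lemma integrable_exp_abs_stdGauss (a : ℝ) : Integrable (fun z => Real.exp (a * |z|)) stdGauss := by
  unfold stdGauss
  exact integrable_exp_mul_abs (X := fun z => z) (integrable_exp_mul_gaussianReal a)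
    (integrable_exp_mul_gaussianReal (-a))

lemma integrable_stdGauss_of_le {F : ℝ → ℝ} (hF : Measurable F) {C a : ℝ}
    (h : ∀ z, |F z| ≤ C * Real.exp (a * |z|)) : Integrable F stdGauss :=
  ((integrable_exp_abs_stdGauss a).const_mul C).mono' hF.aestronglyMeasurable
    (Filter.Eventually.of_forall h)

lemma integral_stdGauss (F : ℝ → ℝ) :
    ∫ z, F z ∂stdGauss = ∫ z, gaussianPDFReal 0 1 z * F z := by
  unfold stdGauss
  rw [integral_gaussianReal_eq_integral_smul one_ne_zero]
  rfl

/-- The Cameron–Martin formula in dimension one. -/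
lemma integral_stdGauss_shift {F : ℝ → ℝ} (u : ℝ) :
    ∫ z, F (z + u) ∂stdGauss = ∫ z, Real.exp (u * z - u ^ 2 / 2) * F z ∂stdGauss := by
  rw [integral_stdGauss, integral_stdGauss,
    ← integral_sub_right_eq_self (fun z => gaussianPDFReal 0 1 z * F (z + u)) u]
  refine integral_congr_ae (Filter.Eventually.of_forall fun z => ?_)
  simp only [gaussianPDFReal, sub_add_cancel, sub_zero, NNReal.coe_one, mul_one]
  rw [← mul_assoc, mul_assoc (_⁻¹) (Real.exp _) (Real.exp _), ← Real.exp_add]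
  congr 3
  ring

namespace ExpBounded

variable {f : ℝ → ℝ}

lemma of_le_one (hf : Measurable f) (h : ∀ x, |f x| ≤ 1) : ExpBounded f :=
  ⟨hf, 1, fun x => (h x).trans (by simp)⟩

lemma comp_affine (hf : ExpBounded f) (x σ : ℝ) :
    Measurable (fun z => f (x + σ * z)) ∧
      ∃ C, 0 ≤ C ∧ ∀ z, |f (x + σ * z)| ≤ C * Real.exp (|σ| * |z|) := by
  obtain ⟨hm, C, hC⟩ := hf
  have hC0 : 0 ≤ C := by simpa using (abs_nonneg _).trans (hC 0)
  refine ⟨hm.comp (by fun_prop), C * Real.exp |x|, by positivity, fun z => (hC _).trans ?_⟩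
  rw [mul_assoc, ← Real.exp_add]
  gcongr
  exact (abs_add_le _ _).trans (by rw [abs_mul])

lemma integrable (hf : ExpBounded f) (x σ : ℝ) :
    Integrable (fun z => f (x + σ * z)) stdGauss := by
  obtain ⟨hm, C, -, hC⟩ := hf.comp_affine x σ
  exact integrable_stdGauss_of_le hm hC

lemma integrable_mul (hf : ExpBounded f) (x σ : ℝ) :
    Integrable (fun z => z * f (x + σ * z)) stdGauss := by
  obtain ⟨hm, C, hC0, hC⟩ := hf.comp_affine x σ
  refine integrable_stdGauss_of_le (C := C) (a := |σ| + 1) (measurable_id.mul hm) fun z => ?_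
  rw [abs_mul, add_mul, Real.exp_add, one_mul, mul_comm, ← mul_assoc]
  exact mul_le_mul (hC z) ((by linarith [abs_nonneg z] : |z| ≤ |z| + 1).trans
    (Real.add_one_le_exp _)) (abs_nonneg _) (by positivity)

/-- Gaussian smoothing differentiates in the space variable, with derivative given by
integration by parts. -/
lemma hasDerivAt (hf : ExpBounded f) {σ : ℝ} (hσ : σ ≠ 0) (x : ℝ) :
    HasDerivAt (fun y => ∫ z, f (y + σ * z) ∂stdGauss)
      ((∫ z, z * f (x + σ * z) ∂stdGauss) / σ) x := by
  obtain ⟨hm, C, hC0, hC⟩ := hf.comp_affine x σ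
  have key : ∀ y, ∫ z, f (y + σ * z) ∂stdGauss =
      ∫ z, Real.exp ((y - x) / σ * z - ((y - x) / σ) ^ 2 / 2) * f (x + σ * z) ∂stdGauss := by
    intro y
    rw [← integral_stdGauss_shift (F := fun z => f (x + σ * z))]
    congr 1 with z
    congr 1
    field_simp
    ring
  have hd : HasDerivAt (fun u : ℝ => ∫ z, Real.exp (u * z) * f (x + σ * z) ∂stdGauss)
      (∫ z, z * Real.exp (0 * z) * f (x + σ * z) ∂stdGauss) 0 := by
    refine (hasDerivAt_integral_of_dominated_loc_of_deriv_le
      (F' := fun u z => z * Real.exp (u * z) * f (x + σ * z))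
      (bound := fun z => C * Real.exp ((|σ| + 2) * |z|))
      (Metric.ball_mem_nhds (0 : ℝ) one_pos) ?_ ?_ ?_ ?_ ?_ ?_).2
    · exact Filter.Eventually.of_forall fun u =>
        (Measurable.mul (by fun_prop) hm).aestronglyMeasurable
    · simpa using hf.integrable x σ
    · exact (Measurable.mul (by fun_prop) hm).aestronglyMeasurable
    · refine Filter.Eventually.of_forall fun z u hu => ?_
      have hu' : |u| ≤ 1 := by simpa using (Metric.mem_ball.1 hu).le
      have h1 : u * z ≤ |z| := (le_abs_self _).trans (by
        rw [abs_mul]; exact mul_le_of_le_one_left (abs_nonneg _) hu')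
      have h2 : |z| ≤ Real.exp |z| :=
        (by linarith : |z| ≤ |z| + 1).trans (Real.add_one_le_exp _)
      rw [Real.norm_eq_abs, abs_mul, abs_mul, Real.abs_exp]
      calc |z| * Real.exp (u * z) * |f (x + σ * z)|
          ≤ Real.exp |z| * Real.exp |z| * (C * Real.exp (|σ| * |z|)) := by
            gcongr
            exact hC z
        _ = C * Real.exp ((|σ| + 2) * |z|) := by
            rw [← Real.exp_add, mul_left_comm, ← Real.exp_add]
            congr 2
            ring
    · exact (integrable_exp_abs_stdGauss _).const_mul C
    · refine Filter.Eventually.of_forall fun z u _ => ?_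
      have : HasDerivAt (fun u : ℝ => Real.exp (u * z)) (z * Real.exp (u * z)) u := by
        simpa [mul_comm] using ((hasDerivAt_id u).mul_const z).exp
      exact this.mul_const _
  have hu : HasDerivAt (fun y : ℝ => (y - x) / σ) (1 / σ) x :=
    ((hasDerivAt_id x).sub_const x).div_const σ
  have hq : HasDerivAt (fun y : ℝ => Real.exp (-(((y - x) / σ) ^ 2 / 2))) 0 x := by
    simpa using ((hu.pow 2).div_const 2).neg.exp
  have h0 : (fun y : ℝ => (y - x) / σ) x = 0 := by simp
  have := hq.mul (HasDerivAt.comp x (h0 ▸ hd) hu)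
  convert! this using 1
  · ext y
    simp only [key y, Pi.mul_apply, Function.comp_apply]
    rw [← integral_const_mul]
    congr 1 with z
    rw [← mul_assoc, ← Real.exp_add]
    congr 2
    ring
  · simp [div_eq_mul_inv]

end ExpBounded

/-- A monotone nonconstant function is positively correlated with the Gaussian variable. -/
lemma integral_mul_pos {f : ℝ → ℝ} (hf : ExpBounded f) (hmono : Monotone f) {a b : ℝ}
    (hab : f a < f b) (x : ℝ) {σ : ℝ} (hσ : 0 < σ) :
    0 < ∫ z, z * f (x + σ * z) ∂stdGauss := by
  have hint := hf.integrable_mul x σ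
  have hid : Integrable (fun z : ℝ => z) stdGauss :=
    memLp_one_iff_integrable.1 (memLp_id_gaussianReal 1)
  have hid0 : ∫ z : ℝ, z ∂stdGauss = 0 := by simp [stdGauss]
  have heq : ∫ z, z * (f (x + σ * z) - f x) ∂stdGauss = ∫ z, z * f (x + σ * z) ∂stdGauss := by
    simp only [mul_sub]
    rw [integral_sub hint (hid.mul_const _), integral_mul_const, hid0]
    simp
  have hint' : Integrable (fun z => z * (f (x + σ * z) - f x)) stdGauss := by
    simp only [mul_sub]
    exact hint.sub (hid.mul_const _)
  have hnn : 0 ≤ fun z => z * (f (x + σ * z) - f x) := by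
    intro z
    rcases le_total 0 z with hz | hz
    · exact mul_nonneg hz (sub_nonneg.2 (hmono (by nlinarith)))
    · exact mul_nonneg_of_nonpos_of_nonpos hz (sub_nonpos.2 (hmono (by nlinarith)))
  rw [← heq, integral_pos_iff_support_of_nonneg hnn hint']
  rcases lt_or_ge (f a) (f x) with h | h
  · have hax : a < x := hmono.reflect_lt h
    refine ((isOpen_Iio (a := (a - x) / σ)).measure_pos stdGauss Set.nonempty_Iio).trans_le
      (measure_mono fun z hz => ?_)
    have hz' : σ * z < a - x := by rwa [Set.mem_Iio, lt_div_iff₀' hσ] at hz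
    refine mul_ne_zero (by rintro rfl; simp at hz'; linarith) (ne_of_lt ?_)
    exact sub_neg.2 ((hmono (by linarith)).trans_lt h)
  · have hb : f x < f b := h.trans_lt hab
    have hxb : x < b := hmono.reflect_lt hb
    refine ((isOpen_Ioi (a := (b - x) / σ)).measure_pos stdGauss Set.nonempty_Ioi).trans_le
      (measure_mono fun z hz => ?_)
    have hz' : b - x < σ * z := by rwa [Set.mem_Ioi, div_lt_iff₀' hσ] at hz
    refine mul_ne_zero (by rintro rfl; simp at hz'; linarith) (ne_of_gt ?_)
    exact sub_pos.2 (hb.trans_le (hmono (by linarith)))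

lemma integral_eq_zero_of_odd {F : ℝ → ℝ} (μ : Measure ℝ) [μ.IsNegInvariant]
    (hF : ∀ z, F (-z) = -F z) : ∫ z, F z ∂μ = 0 := by
  have := integral_neg_eq_self F μ
  simp only [hF, integral_neg] at this
  linarith

/-- The first moment, centred at its mean, of the standard Gaussian tilted by a quadratic. -/
lemma integral_tilt_centered {b : ℝ} (hb : 0 ≤ b) (σ d : ℝ) :
    ∫ z, (z - 2 * b * σ * d / (1 + 2 * b * σ ^ 2)) * Real.exp (-(b * (d - σ * z) ^ 2))
      ∂stdGauss = 0 := by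
  have hp : 0 < 1 + 2 * b * σ ^ 2 := by positivity
  set z₀ := 2 * b * σ * d / (1 + 2 * b * σ ^ 2) with hz₀
  rw [integral_stdGauss, ← integral_add_right_eq_self _ z₀]
  apply integral_eq_zero_of_odd
  have hexp : ∀ z, -(z + z₀) ^ 2 / 2 + -(b * (d - σ * (z + z₀)) ^ 2) =
      -(z ^ 2 * (1 / 2 + b * σ ^ 2)) + (-z₀ ^ 2 / 2 - b * (d - σ * z₀) ^ 2) := by
    intro z
    have : z₀ * (1 + 2 * b * σ ^ 2) = 2 * b * σ * d := by rw [hz₀]; field_simp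
    linear_combination (-z) * this
  have hform : ∀ z, gaussianPDFReal 0 1 (z + z₀) *
      ((z + z₀ - z₀) * Real.exp (-(b * (d - σ * (z + z₀)) ^ 2))) =
      (√(2 * Real.pi))⁻¹ * z * Real.exp (-(z ^ 2 * (1 / 2 + b * σ ^ 2)) +
        (-z₀ ^ 2 / 2 - b * (d - σ * z₀) ^ 2)) := by
    intro z
    rw [← hexp, Real.exp_add]
    simp [gaussianPDFReal]
    ring
  intro z
  rw [hform, hform]
  simp

lemma integral_sq_stdGauss : ∫ z : ℝ, z ^ 2 ∂stdGauss = 1 := by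
  have h := variance_of_integral_eq_zero (μ := gaussianReal 0 1) (X := fun z : ℝ => z)
    (by fun_prop) (by simp)
  rw [variance_fun_id_gaussianReal] at h
  simpa [stdGauss] using h.symm

lemma integral_cube_stdGauss : ∫ z : ℝ, z ^ 3 ∂stdGauss = 0 := by
  rw [integral_stdGauss]
  apply integral_eq_zero_of_odd
  intro z
  simp [gaussianPDFReal, Odd.neg_pow (by decide : Odd 3)]

/-- The properties of `Φ_γ(t,·)` propagated by the Cole–Hopf recursion: `g` is nonpositive of at
most exponential growth, and `g' ≥ max 0 ((κ - x) / l)` with `g' > 0`. -/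
structure ParisiBound (κ l : ℝ) (g : ℝ → ℝ) : Prop where
  diff : Differentiable ℝ g
  deriv_pos : ∀ x, 0 < deriv g x
  le_deriv : ∀ x, (κ - x) / l ≤ deriv g x
  nonpos : ∀ x, g x ≤ 0
  lower : ∃ C, 0 ≤ C ∧ ∀ x, -(C * Real.exp |x|) ≤ g x

lemma gaussTail_eq_integral (κ x : ℝ) {σ : ℝ} (hσ : 0 < σ) :
    gaussTail ((κ - x) / σ) = ∫ z, (Set.Ici κ).indicator 1 (x + σ * z) ∂stdGauss := by
  have : (fun z => (Set.Ici κ).indicator (1 : ℝ → ℝ) (x + σ * z)) =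
      (Set.Ici ((κ - x) / σ)).indicator 1 := by
    ext z
    simp only [Set.indicator_apply, Set.mem_Ici, div_le_iff₀' hσ, sub_le_iff_le_add',
      Pi.one_apply]
  rw [this, integral_indicator_one measurableSet_Ici]
  rfl

lemma gaussTail_lower (v : ℝ) :
    (√(2 * Real.pi))⁻¹ * Real.exp (-((|v| + 1) ^ 2 / 2)) ≤ gaussTail v := by
  have hsub : Set.Icc |v| (|v| + 1) ⊆ Set.Ici v := fun z hz => (le_abs_self v).trans hz.1
  refine le_trans ?_ (ENNReal.toReal_mono (measure_ne_top _ _) (measure_mono hsub))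
  rw [stdGauss, gaussianReal_apply_eq_integral _ one_ne_zero, ENNReal.toReal_ofReal
    (integral_nonneg fun z => gaussianPDFReal_nonneg _ _ _)]
  have := setIntegral_ge_of_const_le_real (μ := volume) (s := Set.Icc |v| (|v| + 1))
    (f := gaussianPDFReal 0 1) (c := (√(2 * Real.pi))⁻¹ * Real.exp (-((|v| + 1) ^ 2 / 2)))
    measurableSet_Icc (by simp) ?_ (integrable_gaussianPDFReal 0 1).integrableOn
  · simpa using this
  · intro z hz
    simp only [gaussianPDFReal, sub_zero, NNReal.coe_one, mul_one, neg_div]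
    gcongr
    · exact (abs_nonneg v).trans hz.1
    · exact hz.2

lemma gaussTail_pos (v : ℝ) : 0 < gaussTail v :=
  lt_of_lt_of_le (by positivity) (gaussTail_lower v)

lemma one_add_sq_le_exp_abs (x : ℝ) : (1 + |x|) ^ 2 ≤ 2 * Real.exp |x| := by
  nlinarith [Real.quadratic_le_exp_of_nonneg (abs_nonneg x)]

lemma log_gaussTail_lower (κ : ℝ) {σ : ℝ} (hσ : 0 < σ) :
    ∃ C, 0 ≤ C ∧ ∀ x, -(C * Real.exp |x|) ≤ Real.log (gaussTail ((κ - x) / σ)) := by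
  set c := (√(2 * Real.pi))⁻¹ with hc
  have hc0 : 0 < c := by positivity
  refine ⟨|Real.log c| + (|κ| + σ + 1) ^ 2 / σ ^ 2, by positivity, fun x => ?_⟩
  have h1 := Real.log_le_log (by positivity) (gaussTail_lower ((κ - x) / σ))
  rw [← hc, Real.log_mul hc0.ne' (Real.exp_ne_zero _), Real.log_exp] at h1
  have hv : |(κ - x) / σ| + 1 ≤ (|κ| + σ + 1) * (1 + |x|) / σ := by
    rw [le_div_iff₀ hσ, abs_div, abs_of_pos hσ, add_mul, div_mul_cancel₀ _ hσ.ne']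
    nlinarith [abs_sub κ x, abs_nonneg κ, abs_nonneg x]
  have h2 : (|(κ - x) / σ| + 1) ^ 2 / 2 ≤ (|κ| + σ + 1) ^ 2 / σ ^ 2 * Real.exp |x| := by
    calc (|(κ - x) / σ| + 1) ^ 2 / 2
        ≤ ((|κ| + σ + 1) * (1 + |x|) / σ) ^ 2 / 2 := by gcongr
      _ = (|κ| + σ + 1) ^ 2 / σ ^ 2 * ((1 + |x|) ^ 2 / 2) := by field_simp
      _ ≤ _ := by
        gcongr
        linarith [one_add_sq_le_exp_abs x]
  have h3 : |Real.log c| ≤ |Real.log c| * Real.exp |x| :=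
    le_mul_of_one_le_right (abs_nonneg _) (Real.one_le_exp (abs_nonneg x))
  linarith [neg_abs_le (Real.log c)]

lemma expBounded_indicator_Ici (κ : ℝ) : ExpBounded ((Set.Ici κ).indicator 1) :=
  .of_le_one (measurable_one.indicator measurableSet_Ici) fun x => by
    by_cases h : x ∈ Set.Ici κ <;> simp [h]

lemma parisiBound_log_gaussTail (κ : ℝ) {l : ℝ} (hl : 0 < l) :
    ParisiBound κ l (fun x => Real.log (gaussTail ((κ - x) / √l))) := by
  have hσ : 0 < √l := Real.sqrt_pos.2 hl
  have hf := expBounded_indicator_Ici κ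
  have hmono : Monotone ((Set.Ici κ).indicator (1 : ℝ → ℝ)) := by
    intro a b hab
    simp only [Set.indicator_apply, Set.mem_Ici, Pi.one_apply]
    split_ifs <;> linarith
  have hd : ∀ x, HasDerivAt (fun x => Real.log (gaussTail ((κ - x) / √l)))
      ((∫ z, z * (Set.Ici κ).indicator 1 (x + √l * z) ∂stdGauss) / √l /
        gaussTail ((κ - x) / √l)) x := by
    intro x
    refine HasDerivAt.log ?_ (gaussTail_pos _).ne'
    simpa only [gaussTail_eq_integral κ _ hσ] using hf.hasDerivAt hσ.ne' x
  refine ⟨fun x => (hd x).differentiableAt, fun x => ?_, fun x => ?_, fun x => ?_,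
    log_gaussTail_lower κ hσ⟩
  · rw [(hd x).deriv]
    exact div_pos (div_pos (integral_mul_pos hf hmono (a := κ - 1) (b := κ) (by simp) x hσ) hσ)
      (gaussTail_pos _)
  · have hle : (κ - x) / √l * gaussTail ((κ - x) / √l) ≤
        ∫ z, z * (Set.Ici κ).indicator 1 (x + √l * z) ∂stdGauss := by
      rw [gaussTail_eq_integral κ x hσ, ← integral_const_mul]
      refine integral_mono ((hf.integrable x _).const_mul _) (hf.integrable_mul x _) fun z => ?_
      by_cases h : κ ≤ x + √l * z
      · simp only [Set.indicator_of_mem (Set.mem_Ici.2 h), Pi.one_apply, mul_one]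
        rw [div_le_iff₀' hσ]
        linarith
      · simp [h]
    rw [(hd x).deriv, le_div_iff₀ (gaussTail_pos _), le_div_iff₀ hσ]
    refine le_trans (le_of_eq ?_) hle
    nth_rewrite 1 [← Real.mul_self_sqrt hl.le]
    field_simp
  · refine Real.log_nonpos (gaussTail_pos _).le ?_
    exact measureReal_le_one

namespace ParisiBound

variable {κ l m s : ℝ} {g : ℝ → ℝ}

lemma strictMono (hg : ParisiBound κ l g) : StrictMono g :=
  strictMono_of_deriv_pos hg.deriv_pos

lemma expBounded (hg : ParisiBound κ l g) : ExpBounded g := by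
  obtain ⟨C, -, hC⟩ := hg.lower
  refine ⟨hg.diff.continuous.measurable, C, fun x => ?_⟩
  rw [abs_of_nonpos (hg.nonpos x)]
  linarith [hC x]

lemma expBounded_exp (hg : ParisiBound κ l g) (hm : 0 ≤ m) :
    ExpBounded fun y => Real.exp (m * g y) :=
  .of_le_one (by have := hg.diff.continuous; fun_prop) fun x => by
    rw [Real.abs_exp, Real.exp_le_one_iff]
    exact mul_nonpos_of_nonneg_of_nonpos hm (hg.nonpos x)

lemma monotone_add_sq (hg : ParisiBound κ l g) :
    Monotone fun y => g y + (κ - y) ^ 2 / (2 * l) := by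
  have hd : ∀ y, HasDerivAt (fun y => g y + (κ - y) ^ 2 / (2 * l))
      (deriv g y - (κ - y) / l) y := by
    intro y
    refine ((hg.diff y).hasDerivAt.add
      ((((hasDerivAt_id y).const_sub κ).pow 2).div_const (2 * l))).congr_deriv ?_
    rw [← mul_div_mul_left (κ - y) l two_ne_zero]
    simp
    ring
  refine monotone_of_deriv_nonneg (fun y => (hd y).differentiableAt) fun y => ?_
  rw [(hd y).deriv]
  exact sub_nonneg.2 (hg.le_deriv y)

/-- The Cole–Hopf step with parameter `0`, which is plain Gaussian smoothing. -/
lemma integral (hg : ParisiBound κ l g) {σ : ℝ} (hσ : 0 < σ) :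
    ParisiBound κ l fun x => ∫ z, g (x + σ * z) ∂stdGauss := by
  have hb := hg.expBounded
  have hd := hb.hasDerivAt hσ.ne'
  refine ⟨fun x => (hd x).differentiableAt, fun x => ?_, fun x => ?_,
    fun x => integral_nonpos fun z => hg.nonpos _, ?_⟩
  · rw [(hd x).deriv]
    exact div_pos (integral_mul_pos hb hg.strictMono.monotone (hg.strictMono zero_lt_one) x hσ) hσ
  · have hp : ∀ k : ℕ, Integrable (fun z : ℝ => z ^ k) stdGauss := fun k =>
      integrable_pow_of_mem_interior_integrableExpSet (X := fun z => z)
        (by simp [stdGauss]) k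
    have hid0 : ∫ z : ℝ, z ∂stdGauss = 0 := by simp [stdGauss]
    have hi1 : Integrable (fun z : ℝ => z) stdGauss := by simpa using hp 1
    set h0 := g x + (κ - x) ^ 2 / (2 * l)
    have hnn : 0 ≤ ∫ z, (z * g (x + σ * z) + ((κ - x) ^ 2 / (2 * l) - h0) * z -
        (κ - x) * σ / l * z ^ 2 + σ ^ 2 / (2 * l) * z ^ 3) ∂stdGauss := by
      refine integral_nonneg fun z => ?_
      have heq : z * g (x + σ * z) + ((κ - x) ^ 2 / (2 * l) - h0) * z -
          (κ - x) * σ / l * z ^ 2 + σ ^ 2 / (2 * l) * z ^ 3 =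
          z * (g (x + σ * z) + (κ - (x + σ * z)) ^ 2 / (2 * l) - h0) := by
        rw [← mul_div_mul_left ((κ - x) * σ) l two_ne_zero]
        ring
      simp only [Pi.zero_apply]
      rw [heq]
      rcases le_total 0 z with hz | hz
      · exact mul_nonneg hz (sub_nonneg.2
          (hg.monotone_add_sq (by nlinarith : x ≤ x + σ * z)))
      · exact mul_nonneg_of_nonpos_of_nonpos hz (sub_nonpos.2
          (hg.monotone_add_sq (by nlinarith : x + σ * z ≤ x)))
    have hiA := hb.integrable_mul x σ
    have hiB := hi1.const_mul ((κ - x) ^ 2 / (2 * l) - h0)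
    have hiC := (hp 2).const_mul ((κ - x) * σ / l)
    have hiD := (hp 3).const_mul (σ ^ 2 / (2 * l))
    have hiAB : Integrable (fun z => z * g (x + σ * z) + ((κ - x) ^ 2 / (2 * l) - h0) * z)
      stdGauss := hiA.add hiB
    have hiABC : Integrable (fun z => z * g (x + σ * z) + ((κ - x) ^ 2 / (2 * l) - h0) * z -
      (κ - x) * σ / l * z ^ 2) stdGauss := hiAB.sub hiC
    rw [integral_add hiABC hiD, integral_sub hiAB hiC, integral_add hiA hiB,
      integral_const_mul, integral_const_mul, integral_const_mul,
      integral_cube_stdGauss, integral_sq_stdGauss, hid0] at hnn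
    rw [(hd x).deriv, le_div_iff₀ hσ, div_mul_eq_mul_div]
    linarith
  · obtain ⟨C, hC0, hC⟩ := hg.lower
    refine ⟨C * ∫ z, Real.exp (σ * |z|) ∂stdGauss, mul_nonneg hC0
      (integral_nonneg fun z => (Real.exp_pos _).le), fun x => ?_⟩
    have hi := (integrable_exp_abs_stdGauss σ).const_mul (-(C * Real.exp |x|))
    calc -(C * (∫ z, Real.exp (σ * |z|) ∂stdGauss) * Real.exp |x|)
        = ∫ z, -(C * Real.exp |x|) * Real.exp (σ * |z|) ∂stdGauss := by
          rw [integral_const_mul]; ring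
      _ ≤ ∫ z, g (x + σ * z) ∂stdGauss := by
          refine integral_mono hi (hb.integrable x σ) fun z => le_trans ?_ (hC _)
          simp only [neg_mul, neg_le_neg_iff]
          rw [mul_assoc, ← Real.exp_add]
          gcongr
          exact (abs_add_le _ _).trans (by rw [abs_mul, abs_of_pos hσ])

lemma half_exp_le (hg : ParisiBound κ l g) (hm : 0 ≤ m) {σ : ℝ} (hσ : 0 < σ) (x : ℝ) :
    Real.exp (m * g x) / 2 ≤ ∫ z, Real.exp (m * g (x + σ * z)) ∂stdGauss := by
  have hsymm : stdGauss.real (Set.Iic 0) = stdGauss.real (Set.Ici 0) := by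
    have h : stdGauss.map (fun z => -z) = stdGauss := by
      simp [stdGauss, gaussianReal_map_neg]
    have := map_measureReal_apply (μ := stdGauss) measurable_neg (measurableSet_Ici (a := (0:ℝ)))
    rw [h] at this
    simpa using this.symm
  have hhalf : 1 / 2 ≤ stdGauss.real (Set.Ici 0) := by
    have := measureReal_union_le (μ := stdGauss) (Set.Iic (0:ℝ)) (Set.Ici 0)
    rw [Set.Iic_union_Ici, probReal_univ] at this
    linarith
  have hi := (hg.expBounded_exp hm).integrable x σ
  calc Real.exp (m * g x) / 2 ≤ Real.exp (m * g x) * stdGauss.real (Set.Ici 0) := by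
        rw [div_eq_mul_one_div]; gcongr
    _ ≤ ∫ z in Set.Ici 0, Real.exp (m * g (x + σ * z)) ∂stdGauss := by
        refine setIntegral_ge_of_const_le_real measurableSet_Ici (measure_ne_top _ _) ?_
          hi.integrableOn
        intro z hz
        have : g x ≤ g (x + σ * z) :=
          hg.strictMono.monotone (by have := mul_nonneg hσ.le hz; linarith)
        gcongr
    _ ≤ _ := setIntegral_le_integral hi (Filter.Eventually.of_forall fun z => (Real.exp_pos _).le)

/-- The Cole–Hopf step with positive parameter. -/
lemma log_integral_exp (hg : ParisiBound κ l g) (hl : 0 < l) (hm : 0 < m) {σ : ℝ} (hσ : 0 < σ) :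
    ParisiBound κ (l + m * σ ^ 2) fun x =>
      1 / m * Real.log (∫ z, Real.exp (m * g (x + σ * z)) ∂stdGauss) := by
  have hb := hg.expBounded_exp hm.le
  have hmono : StrictMono fun y => Real.exp (m * g y) := fun a b hab =>
    Real.exp_lt_exp.2 (mul_lt_mul_of_pos_left (hg.strictMono hab) hm)
  have hpos : ∀ x, 0 < ∫ z, Real.exp (m * g (x + σ * z)) ∂stdGauss := fun x =>
    lt_of_lt_of_le (by positivity) (hg.half_exp_le hm.le hσ x)
  have hd := fun x => ((hb.hasDerivAt hσ.ne' x).log (hpos x).ne').const_mul (1 / m)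
  refine ⟨fun x => (hd x).differentiableAt, fun x => ?_, fun x => ?_, fun x => ?_, ?_⟩
  · rw [(hd x).deriv]
    have := integral_mul_pos hb hmono.monotone (hmono zero_lt_one) x hσ
    have := hpos x
    positivity
  · set b := m / (2 * l) with hbdef
    set z₀ := 2 * b * σ * (κ - x) / (1 + 2 * b * σ ^ 2) with hz₀
    have hb0 : 0 ≤ b := by positivity
    have hz : z₀ = m * σ * (κ - x) / (l + m * σ ^ 2) := by
      rw [hz₀, hbdef]
      field_simp
    have hle : z₀ * ∫ z, Real.exp (m * g (x + σ * z)) ∂stdGauss ≤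
        ∫ z, z * Real.exp (m * g (x + σ * z)) ∂stdGauss := by
      set w := Real.exp (m * (g (x + σ * z₀) + (κ - (x + σ * z₀)) ^ 2 / (2 * l)))
      have hq : ExpBounded fun z => Real.exp (-(b * (κ - z) ^ 2)) :=
        .of_le_one (by fun_prop) fun z => by
          rw [Real.abs_exp, Real.exp_le_one_iff]
          exact neg_nonpos.2 (by positivity)
      have hint : Integrable
          (fun z => w * ((z - z₀) * Real.exp (-(b * (κ - x - σ * z) ^ 2)))) stdGauss := by
        simp only [sub_mul, sub_sub]
        exact ((hq.integrable_mul x σ).sub ((hq.integrable x σ).const_mul _)).const_mul _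
      have h0 : ∫ z, w * ((z - z₀) * Real.exp (-(b * (κ - x - σ * z) ^ 2))) ∂stdGauss = 0 := by
        rw [integral_const_mul, integral_tilt_centered hb0 σ (κ - x), mul_zero]
      have hi1 := hb.integrable_mul x σ
      have hi2 := (hb.integrable x σ).const_mul z₀
      rw [← sub_nonneg, ← integral_const_mul, ← integral_sub hi1 hi2, ← h0]
      refine integral_mono hint (hi1.sub hi2) fun z => ?_
      have hfac : Real.exp (m * g (x + σ * z)) =
          Real.exp (m * (g (x + σ * z) + (κ - (x + σ * z)) ^ 2 / (2 * l))) *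
            Real.exp (-(b * (κ - x - σ * z) ^ 2)) := by
        rw [← Real.exp_add, hbdef]
        congr 1
        ring
      have hmain : 0 ≤ (z - z₀) *
          (Real.exp (m * (g (x + σ * z) + (κ - (x + σ * z)) ^ 2 / (2 * l))) - w) := by
        rcases le_total z₀ z with h | h
        · refine mul_nonneg (sub_nonneg.2 h) (sub_nonneg.2 (Real.exp_le_exp.2
            (mul_le_mul_of_nonneg_left (hg.monotone_add_sq ?_) hm.le)))
          gcongr
        · refine mul_nonneg_of_nonpos_of_nonpos (sub_nonpos.2 h) (sub_nonpos.2 (Real.exp_le_exp.2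
            (mul_le_mul_of_nonneg_left (hg.monotone_add_sq ?_) hm.le)))
          gcongr
      have := mul_nonneg hmain (Real.exp_pos (-(b * (κ - x - σ * z) ^ 2))).le
      simp only
      rw [hfac]
      linarith
    rw [(hd x).deriv, ← mul_div_assoc, le_div_iff₀ (hpos x), ← mul_div_assoc, le_div_iff₀ hσ,
      one_div, inv_mul_eq_div, le_div_iff₀ hm]
    refine le_trans (le_of_eq ?_) hle
    rw [hz]
    ring
  · refine mul_nonpos_of_nonneg_of_nonpos (by positivity) (Real.log_nonpos (hpos x).le ?_)
    refine (integral_mono (hb.integrable x σ) (integrable_const 1) fun z => ?_).trans (by simp)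
    exact Real.exp_le_one_iff.2 (mul_nonpos_of_nonneg_of_nonpos hm.le (hg.nonpos _))
  · obtain ⟨C, hC0, hC⟩ := hg.lower
    have hlog2 := Real.log_nonneg one_le_two
    refine ⟨C + Real.log 2 / m, by positivity, fun x => ?_⟩
    have h1 := Real.log_le_log (by positivity) (hg.half_exp_le hm.le hσ x)
    rw [Real.log_div (Real.exp_ne_zero _) two_ne_zero, Real.log_exp] at h1
    have h2 : Real.log 2 / m ≤ Real.log 2 / m * Real.exp |x| :=
      le_mul_of_one_le_right (by positivity) (Real.one_le_exp (abs_nonneg x))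
    calc -((C + Real.log 2 / m) * Real.exp |x|) ≤ g x - Real.log 2 / m := by linarith [hC x]
      _ = 1 / m * (m * g x - Real.log 2) := by field_simp
      _ ≤ _ := by gcongr

lemma coleHopf (hg : ParisiBound κ l g) (hl : 0 < l) (hm : 0 ≤ m) (hs : 0 < s) :
    ParisiBound κ (l + m * s) (coleHopf m s g) := by
  have hσ : 0 < √s := Real.sqrt_pos.2 hs
  rcases hm.eq_or_lt with rfl | hm
  · convert! hg.integral hσ using 1
    · ring
    · ext x
      rw [_root_.coleHopf, if_neg (lt_irrefl 0)]
  · have := hg.log_integral_exp hl hm hσ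
    rw [Real.sq_sqrt hs.le] at this
    convert! this using 1
    ext x
    rw [_root_.coleHopf, if_pos hm]

end ParisiBound

namespace StepFn

variable (γ : StepFn)

lemma q_le {i j : ℕ} (hij : i ≤ j) (hj : j ≤ γ.n + 1) : γ.q i ≤ γ.q j := by
  induction j, hij using Nat.le_induction with
  | base => exact le_rfl
  | succ k _ ih => exact (ih (by omega)).trans (γ.q_lt k (by omega)).le

lemma m_nonneg {i : ℕ} (hi : i ≤ γ.n) : 0 ≤ γ.m i := by
  induction i with
  | zero => exact γ.m_zero.ge
  | succ k ih => exact (ih (by omega)).trans (γ.m_mono k (by omega))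

open Classical in
lemma findGreatest_eq {i : ℕ} (hi : i ≤ γ.n) {t : ℝ} (ht : t ∈ Set.Ico (γ.q i) (γ.q (i + 1))) :
    Nat.findGreatest (fun i => γ.q i ≤ t) γ.n = i := by
  refine Nat.findGreatest_eq_iff.2 ⟨hi, fun _ => ht.1, fun k hk hkn => ?_⟩
  exact not_le.2 (ht.2.trans_le (γ.q_le hk (by omega)))

lemma toFun_eq {i : ℕ} (hi : i ≤ γ.n) {t : ℝ} (ht : t ∈ Set.Ico (γ.q i) (γ.q (i + 1))) :
    γ.toFun t = γ.m i := by
  have h0 : 0 ≤ t := γ.q_zero.ge.trans ((γ.q_le i.zero_le (by omega)).trans ht.1)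
  have h1 : t < 1 := ht.2.trans_le ((γ.q_le (by omega) le_rfl).trans γ.q_last.le)
  rw [toFun, if_pos ⟨h0, h1⟩, γ.findGreatest_eq hi ht]

lemma intervalIntegrable_toFun_piece {i : ℕ} (hi : i ≤ γ.n) {t : ℝ}
    (ht : t ∈ Set.Ico (γ.q i) (γ.q (i + 1))) :
    IntervalIntegrable γ.toFun volume t (γ.q (i + 1)) := by
  refine (intervalIntegrable_const (c := γ.m i)).congr_uIoo fun s hs => ?_
  rw [Set.uIoo_of_le ht.2.le] at hs
  exact (γ.toFun_eq hi ⟨ht.1.trans hs.1.le, hs.2⟩).symm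

lemma integral_toFun_piece {i : ℕ} (hi : i ≤ γ.n) {t : ℝ}
    (ht : t ∈ Set.Ico (γ.q i) (γ.q (i + 1))) :
    ∫ s in t..γ.q (i + 1), γ.toFun s = γ.m i * (γ.q (i + 1) - t) := by
  rw [intervalIntegral.integral_of_le ht.2.le, integral_Ioc_eq_integral_Ioo,
    setIntegral_congr_fun (g := fun _ => γ.m i) measurableSet_Ioo fun s hs =>
      γ.toFun_eq hi ⟨ht.1.trans hs.1.le, hs.2⟩]
  simp [ht.2.le, mul_comm]

lemma parisiBound_phiAux (κ : ℝ) {j : ℕ} (hj : j ≤ γ.n) {t : ℝ}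
    (ht : t ∈ Set.Ico (γ.q (γ.n - j)) (γ.q (γ.n - j + 1))) :
    IntervalIntegrable γ.toFun volume t 1 ∧ 0 < ∫ s in t..(1 : ℝ), γ.toFun s ∧
      ParisiBound κ (∫ s in t..(1 : ℝ), γ.toFun s) (γ.PhiAux κ j t) := by
  have hI := γ.intervalIntegrable_toFun_piece (by omega) ht
  have hE := γ.integral_toFun_piece (by omega) ht
  induction j generalizing t with
  | zero =>
    simp only [Nat.sub_zero, γ.q_last, γ.m_last, one_mul] at ht hI hE
    refine ⟨hI, ?_⟩
    rw [hE]
    have h : 0 < 1 - t := sub_pos.2 ht.2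
    exact ⟨h, parisiBound_log_gaussTail κ h⟩
  | succ j ih =>
    have hk : γ.n - (j + 1) + 1 = γ.n - j := by omega
    rw [hk] at ht hI hE
    have hmem : γ.q (γ.n - j) ∈ Set.Ico (γ.q (γ.n - j)) (γ.q (γ.n - j + 1)) :=
      ⟨le_rfl, γ.q_lt _ (by omega)⟩
    obtain ⟨hI', hpos, hP⟩ := ih (by omega) hmem
      (γ.intervalIntegrable_toFun_piece (by omega) hmem)
      (γ.integral_toFun_piece (by omega) hmem)
    have hm := γ.m_nonneg (i := γ.n - (j + 1)) (by omega)
    have hs : 0 < γ.q (γ.n - j) - t := sub_pos.2 ht.2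
    have hsum : ∫ s in t..(1 : ℝ), γ.toFun s =
        (∫ s in γ.q (γ.n - j)..(1 : ℝ), γ.toFun s) +
          γ.m (γ.n - (j + 1)) * (γ.q (γ.n - j) - t) := by
      rw [← intervalIntegral.integral_add_adjacent_intervals hI hI', hE, add_comm]
    refine ⟨hI.trans hI', ?_⟩
    rw [hsum]
    exact ⟨by positivity, hP.coleHopf hpos hm hs⟩

open Classical in
lemma parisiBound_phi (κ : ℝ) {t : ℝ} (ht : t ∈ Set.Icc 0 γ.qbar) :
    ParisiBound κ (∫ s in t..(1 : ℝ), γ.toFun s) (γ.Phi κ t) := by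
  set i := Nat.findGreatest (fun i => γ.q i ≤ t) γ.n
  have hin : i ≤ γ.n := Nat.findGreatest_le _
  have h1 : γ.q i ≤ t := Nat.findGreatest_spec (P := fun i => γ.q i ≤ t) γ.n.zero_le
    (γ.q_zero.le.trans ht.1)
  have h2 : t < γ.q (i + 1) := by
    rcases hin.eq_or_lt with h | h
    · rw [h]
      exact ht.2.trans_lt (γ.q_lt _ le_rfl)
    · exact not_le.1 (Nat.findGreatest_is_greatest (P := fun i => γ.q i ≤ t) (Nat.lt_succ_self i) h)
  have hsub : γ.n - (γ.n - i) = i := by omega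
  exact (γ.parisiBound_phiAux κ (j := γ.n - i) (by omega) (by rw [hsub]; exact ⟨h1, h2⟩)).2.2

end StepFn

/-- lower bound in Proposition 4.1, Eq. (4.8): for `γ ∈ SF⁺` and every
`t ∈ [0,q̄]`, the function `x ↦ Φ_γ(t,x)` is differentiable with
`∂ₓΦ_γ(t,x) ≥ max(0, (κ−x)/λ(t))`, where `λ(t) = ∫_t^1 γ(s) ds`; in particular
`∂ₓΦ_γ(t,x) > 0` everywhere on `[0,q̄] × ℝ`. -/
theorem statement_1 (κ : ℝ) (γ : StepFn) :
    ∀ t ∈ Set.Icc (0 : ℝ) γ.qbar,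
      Differentiable ℝ (fun x => γ.Phi κ t x) ∧
      ∀ x : ℝ,
        max 0 ((κ - x) / ∫ s in t..(1 : ℝ), γ.toFun s) ≤ deriv (fun y => γ.Phi κ t y) x ∧
        0 < deriv (fun y => γ.Phi κ t y) x := by
  intro t ht
  have h := γ.parisiBound_phi κ ht
  exact ⟨h.diff, fun x => ⟨max_le (h.deriv_pos x).le (h.le_deriv x), h.deriv_pos x⟩⟩
end

section
/- Let γ ∈ SF⁺ with q̄ = q̄(γ). There exists a constant C > 0 depending only on κ and q̄ such that for all (t,x) ∈ [0,q̄] × ℝ one has ∂ₓΦ_γ(t,x) ≤ C·(1 + max((κ−x)/√(1−q̄), 1)), and the same constant works for every γ ∈ SF⁺ with q̄(γ) = q̄. (Upper bound in Proposition 4.1, Eq. (4.8).) -/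
open MeasureTheory ProbabilityTheory

instance isProbabilityMeasure_stdGauss : IsProbabilityMeasure stdGauss := by
  unfold stdGauss; infer_instance

/-- Jensen's inequality for `x ↦ x ^ m` with `0 ≤ m ≤ 1` and a weight `w`. -/
lemma integral_mul_rpow_le {α : Type*} [MeasurableSpace α] {μ : Measure α} {w V : α → ℝ} {m : ℝ}
    (hm0 : 0 ≤ m) (hm1 : m ≤ 1) (hw : ∀ a, 0 ≤ w a) (hV : ∀ a, 0 < V a)
    (hwi : Integrable w μ) (hwV : Integrable (fun a => w a * V a) μ)
    (hw0 : 0 < ∫ a, w a ∂μ) (hwV0 : 0 < ∫ a, w a * V a ∂μ) :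
    ∫ a, w a * V a ^ m ∂μ ≤ (∫ a, w a ∂μ) * ((∫ a, w a * V a ∂μ) / ∫ a, w a ∂μ) ^ m := by
  set l := (∫ a, w a * V a ∂μ) / ∫ a, w a ∂μ with hl
  have hl0 : 0 < l := div_pos hwV0 hw0
  have key : ∀ a, w a * V a ^ m ≤ l ^ m * ((1 - m) * w a + m / l * (w a * V a)) := by
    intro a
    have h1 := rpow_one_add_le_one_add_mul_self
      (s := V a / l - 1) (by have := div_pos (hV a) hl0; linarith) hm0 hm1
    rw [add_sub_cancel, Real.div_rpow (hV a).le hl0.le,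
      div_le_iff₀ (Real.rpow_pos_of_pos hl0 m)] at h1
    calc w a * V a ^ m ≤ w a * ((1 + m * (V a / l - 1)) * l ^ m) := by gcongr; exact hw a
      _ = _ := by ring
  have hint : Integrable (fun a => l ^ m * ((1 - m) * w a + m / l * (w a * V a))) μ :=
    ((hwi.const_mul _).add (hwV.const_mul _)).const_mul _
  calc ∫ a, w a * V a ^ m ∂μ
      ≤ ∫ a, l ^ m * ((1 - m) * w a + m / l * (w a * V a)) ∂μ :=
        integral_mono_of_nonneg
          (Filter.Eventually.of_forall fun a => mul_nonneg (hw a) (Real.rpow_nonneg (hV a).le m))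
          hint (Filter.Eventually.of_forall key)
    _ = _ := by
        rw [integral_const_mul, integral_add (hwi.const_mul _) (hwV.const_mul _),
          integral_const_mul, integral_const_mul]
        have : ∫ a, w a * V a ∂μ = l * ∫ a, w a ∂μ := by rw [hl]; field_simp
        rw [this]
        field_simp
        ring

/-- Chebyshev's association inequality for a monotone and an antitone function. -/
lemma integral_mul_le_of_monotone_antitone {μ : Measure ℝ} [IsProbabilityMeasure μ] {f g : ℝ → ℝ}
    (hf : Monotone f) (hg : Antitone g) (hfi : Integrable f μ) (hgi : Integrable g μ)
    (hfg : Integrable (fun x => f x * g x) μ) :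
    ∫ x, f x * g x ∂μ ≤ (∫ x, f x ∂μ) * ∫ x, g x ∂μ := by
  have hpt : ∀ x y, (f x - f y) * (g x - g y) ≤ 0 := by
    intro x y
    rcases le_total x y with h | h
    · exact mul_nonpos_of_nonpos_of_nonneg (sub_nonpos.2 (hf h)) (sub_nonneg.2 (hg h))
    · exact mul_nonpos_of_nonneg_of_nonpos (sub_nonneg.2 (hf h)) (sub_nonpos.2 (hg h))
  set F := ∫ x, f x ∂μ
  set G := ∫ x, g x ∂μ
  set P := ∫ x, f x * g x ∂μ
  have inner : ∀ x, f x * g x - f x * G - F * g x + P ≤ 0 := by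
    intro x
    have : ∫ y, (f x - f y) * (g x - g y) ∂μ = f x * g x - f x * G - F * g x + P := by
      have e : ∀ y, (f x - f y) * (g x - g y)
          = ((f x * g x - f x * g y) - g x * f y) + f y * g y := fun y => by ring
      have i1 : Integrable (fun y => f x * g x - f x * g y) μ :=
        (integrable_const _).sub (hgi.const_mul _)
      have i2 : Integrable (fun y => f x * g x - f x * g y - g x * f y) μ :=
        i1.sub (hfi.const_mul _)
      simp_rw [e]
      rw [integral_add i2 hfg, integral_sub i1 (hfi.const_mul _),
        integral_sub (integrable_const _) (hgi.const_mul _)]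
      simp only [integral_const_mul, integral_const, probReal_univ, smul_eq_mul, one_mul]
      ring
    rw [← this]
    exact integral_nonpos fun y => hpt x y
  have outer : ∫ x, (f x * g x - f x * G - F * g x + P) ∂μ = P - F * G - F * G + P := by
    have i1 : Integrable (fun x => f x * g x - f x * G) μ := hfg.sub (hfi.mul_const _)
    have i2 : Integrable (fun x => f x * g x - f x * G - F * g x) μ := i1.sub (hgi.const_mul _)
    rw [integral_add i2 (integrable_const _), integral_sub i1 (hgi.const_mul _),
      integral_sub hfg (hfi.mul_const _), integral_mul_const, integral_const_mul]
    simp [F, G, P]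
  have := integral_nonpos (μ := μ) inner
  rw [outer] at this
  linarith

/-- The Cameron–Martin formula for the standard Gaussian measure on the line. -/
lemma integral_add_const_stdGauss (g : ℝ → ℝ) (a : ℝ) :
    ∫ w, g (w + a) ∂stdGauss = ∫ w, g w * Real.exp (a * w - a ^ 2 / 2) ∂stdGauss := by
  unfold stdGauss
  rw [integral_gaussianReal_eq_integral_smul one_ne_zero,
    integral_gaussianReal_eq_integral_smul one_ne_zero,
    ← integral_sub_right_eq_self _ a]
  refine integral_congr_ae (Filter.Eventually.of_forall fun w => ?_)
  simp only [sub_add_cancel, smul_eq_mul, gaussianPDFReal]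
  have : Real.exp (-(w - a - 0) ^ 2 / (2 * ((1 : NNReal) : ℝ)))
      = Real.exp (-(w - 0) ^ 2 / (2 * ((1 : NNReal) : ℝ))) * Real.exp (a * w - a ^ 2 / 2) := by
    rw [← Real.exp_add]; congr 1; push_cast; ring
  rw [this]; ring

lemma integrable_exp_mul_stdGauss (t : ℝ) : Integrable (fun x => Real.exp (t * x)) stdGauss :=
  integrable_exp_mul_gaussianReal t

lemma integrable_exp_mul_abs_stdGauss (t : ℝ) :
    Integrable (fun x => Real.exp (t * |x|)) stdGauss :=
  integrable_exp_mul_abs (X := fun x : ℝ => x) (integrable_exp_mul_stdGauss t)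
    (integrable_exp_mul_stdGauss (-t))

lemma integrable_indicator_one_stdGauss {s : Set ℝ} (hs : MeasurableSet s) :
    Integrable (s.indicator (fun _ => (1 : ℝ))) stdGauss :=
  (integrable_const (1 : ℝ)).indicator hs

lemma gaussTail_eq_integral_s2 (v : ℝ) :
    gaussTail v = ∫ w, (Set.Ici v).indicator (fun _ => (1 : ℝ)) w ∂stdGauss := by
  rw [integral_indicator measurableSet_Ici]
  simp [gaussTail, Measure.real]

lemma gaussTail_eq_integral_exp (v h : ℝ) :
    gaussTail (v - h) = ∫ w, (Set.Ici v).indicator (fun _ => (1 : ℝ)) w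
      * Real.exp (h * w - h ^ 2 / 2) ∂stdGauss := by
  rw [← integral_add_const_stdGauss, gaussTail_eq_integral_s2]
  congr 1; ext w
  simp [Set.indicator]

lemma gaussTail_antitone : Antitone gaussTail := fun _ _ h =>
  ENNReal.toReal_mono (measure_ne_top _ _) (measure_mono (Set.Ici_subset_Ici.2 h))

lemma gaussTail_le_one (v : ℝ) : gaussTail v ≤ 1 := measureReal_le_one

/-- A Gaussian lower bound on the tail of the standard Gaussian law. -/
lemma exists_le_gaussTail :
    ∃ c > 0, ∀ v : ℝ, c * Real.exp (-|v| - v ^ 2 / 2) ≤ gaussTail v := by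
  refine ⟨∫ w, (Set.Icc (0 : ℝ) 1).indicator (fun _ => (1 : ℝ)) w ∂stdGauss, ?_, fun v => ?_⟩
  · rw [integral_indicator measurableSet_Icc]
    simp only [integral_const, smul_eq_mul, mul_one, measureReal_restrict_apply_univ]
    rw [gt_iff_lt, measureReal_def, ENNReal.toReal_pos_iff]
    refine ⟨pos_iff_ne_zero.2 fun h => ?_, measure_lt_top _ _⟩
    have := gaussianReal_absolutelyContinuous' 0 (one_ne_zero : (1 : NNReal) ≠ 0) h
    simp at this
  · have := gaussTail_eq_integral_exp 0 (-v)
    rw [zero_sub, neg_neg] at this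
    rw [this, ← integral_mul_const]
    refine integral_mono ((integrable_indicator_one_stdGauss measurableSet_Icc).mul_const _) ?_
      fun w => ?_
    · have h1 : Integrable (fun w => Real.exp (-v * w - (-v) ^ 2 / 2)) stdGauss := by
        simp_rw [Real.exp_sub]
        exact (integrable_exp_mul_stdGauss _).div_const _
      refine (h1.indicator measurableSet_Ici (s := Set.Ici 0)).congr
        (Filter.Eventually.of_forall fun w => ?_)
      by_cases hw : 0 ≤ w <;> simp [Set.indicator, hw]
    · by_cases hw : w ∈ Set.Icc (0 : ℝ) 1
      · have hw' : w ∈ Set.Ici (0 : ℝ) := hw.1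
        simp only [Set.indicator_of_mem hw, Set.indicator_of_mem hw', one_mul]
        rw [Real.exp_le_exp, neg_sq]
        have : v * w ≤ |v| := by
          calc v * w ≤ |v| * w := by gcongr; exact le_abs_self v
            _ ≤ |v| * 1 := by gcongr; exact hw.2
            _ = |v| := mul_one _
        linarith
      · simp only [Set.indicator_of_notMem hw, zero_mul]
        exact mul_nonneg (Set.indicator_nonneg (fun _ _ => zero_le_one) _) (Real.exp_pos _).le

lemma gaussTail_sub_one_le (v : ℝ) :
    gaussTail (v - 1) ≤ Real.exp (3 / 2 + max v 0) * gaussTail v := by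
  have hsplit : ∀ a b : ℝ, a ≤ b → gaussTail a = gaussTail b
      + ∫ w, (Set.Ico a b).indicator (fun _ => (1 : ℝ)) w ∂stdGauss := by
    intro a b hab
    rw [gaussTail_eq_integral_s2, gaussTail_eq_integral_s2,
      ← integral_add (integrable_indicator_one_stdGauss measurableSet_Ici)
        (integrable_indicator_one_stdGauss measurableSet_Ico)]
    congr 1; ext w
    by_cases h1 : a ≤ w <;> by_cases h2 : b ≤ w <;>
      simp [Set.indicator, h1, h2]
    linarith
  have hle : (∫ w, (Set.Ico (v - 1) v).indicator (fun _ => (1 : ℝ)) w ∂stdGauss)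
      * Real.exp (-v - 1 / 2) ≤ gaussTail v := by
    have h1 : ∫ w, (Set.Ico v (v + 1)).indicator (fun _ => (1 : ℝ)) w ∂stdGauss
        = ∫ w, (Set.Ico (v - 1) v).indicator (fun _ => (1 : ℝ)) w
          * Real.exp ((-1) * w - (-1) ^ 2 / 2) ∂stdGauss := by
      rw [← integral_add_const_stdGauss]
      congr 1; ext w
      simp only [Set.indicator, Set.mem_Ico]
      congr 1
      simp only [eq_iff_iff]
      constructor <;> rintro ⟨h1, h2⟩ <;> constructor <;> linarith
    have h2 : gaussTail v ≥ ∫ w, (Set.Ico v (v + 1)).indicator (fun _ => (1 : ℝ)) w ∂stdGauss := by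
      rw [hsplit v (v + 1) (by linarith)]
      linarith [gaussTail_pos (v + 1)]
    refine le_trans ?_ h2
    rw [h1, ← integral_mul_const]
    refine integral_mono_of_nonneg (Filter.Eventually.of_forall fun w => mul_nonneg
      (Set.indicator_nonneg (fun _ _ => zero_le_one) _) (Real.exp_pos _).le) ?_
      (Filter.Eventually.of_forall fun w => ?_)
    · have h1 : Integrable (fun w => Real.exp ((-1) * w - (-1) ^ 2 / 2)) stdGauss := by
        simp_rw [Real.exp_sub]
        exact (integrable_exp_mul_stdGauss _).div_const _
      refine (h1.indicator (measurableSet_Ico (a := v - 1) (b := v))).congr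
        (Filter.Eventually.of_forall fun w => ?_)
      by_cases hw : w ∈ Set.Ico (v - 1) v <;>
        simp only [Set.indicator_of_mem, Set.indicator_of_notMem, hw, one_mul, zero_mul,
          not_false_eq_true]
    · by_cases hw : w ∈ Set.Ico (v - 1) v
      · simp only [Set.indicator_of_mem hw, one_mul]
        rw [Real.exp_le_exp]
        linarith [hw.2]
      · simp only [Set.indicator_of_notMem hw, zero_mul, le_refl]
  rw [hsplit (v - 1) v (by linarith)]
  have h3 : (∫ w, (Set.Ico (v - 1) v).indicator (fun _ => (1 : ℝ)) w ∂stdGauss)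
      ≤ gaussTail v * Real.exp (v + 1 / 2) := by
    rw [← div_le_iff₀ (Real.exp_pos _), div_eq_mul_inv, ← Real.exp_neg]
    rwa [show -(v + 1 / 2) = -v - 1 / 2 by ring]
  have h4 : Real.exp (v + 1 / 2) ≤ Real.exp (1 / 2 + max v 0) := by
    rw [Real.exp_le_exp]; linarith [le_max_left v 0]
  have h5 : 1 ≤ Real.exp (1 / 2 + max v 0) := by
    rw [Real.one_le_exp_iff]; linarith [le_max_right v 0]
  have h6 : Real.exp (3 / 2 + max v 0) = Real.exp 1 * Real.exp (1 / 2 + max v 0) := by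
    rw [← Real.exp_add]; congr 1; ring
  have h7 : (2 : ℝ) ≤ Real.exp 1 := by linarith [Real.add_one_le_exp (1 : ℝ)]
  have hg := gaussTail_pos v
  rw [h6]
  nlinarith [mul_le_mul_of_nonneg_left h4 hg.le, mul_le_mul_of_nonneg_left h5 hg.le,
    mul_le_mul_of_nonneg_right h7 (mul_pos (Real.exp_pos (1 / 2 + max v 0)) hg).le]

/-- Increments of the logarithm of the Gaussian tail grow at most linearly. -/
lemma log_gaussTail_sub_le {h : ℝ} (h0 : 0 < h) (h1 : h ≤ 1) (v : ℝ) :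
    Real.log (gaussTail (v - h)) ≤ Real.log (gaussTail v) + h * (2 + max v 0) := by
  set w : ℝ → ℝ := (Set.Ici v).indicator (fun _ => (1 : ℝ)) with hw
  have hw0 : ∀ z, 0 ≤ w z := Set.indicator_nonneg (fun _ _ => zero_le_one)
  have hwi : Integrable w stdGauss := integrable_indicator_one_stdGauss measurableSet_Ici
  have hW : ∀ t : ℝ, Integrable (fun z => w z * Real.exp (t * z)) stdGauss := by
    intro t
    refine ((integrable_exp_mul_stdGauss t).indicator (measurableSet_Ici (a := v))).congr
      (Filter.Eventually.of_forall fun z => ?_)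
    by_cases hz : v ≤ z <;> simp [hw, Set.indicator, hz]
  have htail : ∀ t : ℝ, ∫ z, w z * Real.exp (t * z) ∂stdGauss
      = Real.exp (t ^ 2 / 2) * gaussTail (v - t) := by
    intro t
    rw [gaussTail_eq_integral_exp, ← integral_const_mul]
    congr 1; ext z
    rw [sub_eq_add_neg, Real.exp_add, Real.exp_neg, ← hw]
    field_simp
  have hJ := integral_mul_rpow_le (μ := stdGauss) (w := w) (V := fun z => Real.exp (1 * z))
    h0.le h1 hw0 (fun _ => Real.exp_pos _) hwi (hW 1)
    (by rw [hw, ← gaussTail_eq_integral_s2]; exact gaussTail_pos v)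
    (by rw [htail]; exact mul_pos (Real.exp_pos _) (gaussTail_pos _))
  simp only [← Real.exp_mul] at hJ
  have e : ∀ z : ℝ, 1 * z * h = h * z := fun z => by ring
  simp only [e] at hJ
  rw [htail, htail, hw, ← gaussTail_eq_integral_s2] at hJ
  have hN := gaussTail_pos v
  have hb : Real.exp (1 ^ 2 / 2) * gaussTail (v - 1) / gaussTail v ≤ Real.exp (2 + max v 0) := by
    rw [div_le_iff₀ hN]
    calc _ ≤ Real.exp (1 ^ 2 / 2) * (Real.exp (3 / 2 + max v 0) * gaussTail v) := by
          gcongr; exact gaussTail_sub_one_le v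
      _ = _ := by rw [← mul_assoc, ← Real.exp_add]; congr 2; ring
  have hfin : gaussTail (v - h) ≤ gaussTail v * Real.exp (h * (2 + max v 0)) := by
    calc gaussTail (v - h) ≤ Real.exp (h ^ 2 / 2) * gaussTail (v - h) :=
          le_mul_of_one_le_left (gaussTail_pos _).le (Real.one_le_exp_iff.2 (by positivity))
      _ ≤ _ := hJ
      _ ≤ gaussTail v * (Real.exp (2 + max v 0)) ^ h := by
          have := gaussTail_pos (v - 1)
          gcongr
      _ = _ := by rw [← Real.exp_mul, mul_comm h]
  calc _ ≤ Real.log (gaussTail v * Real.exp (h * (2 + max v 0))) :=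
        Real.log_le_log (gaussTail_pos _) hfin
    _ = _ := by rw [Real.log_mul hN.ne' (Real.exp_pos _).ne', Real.log_exp]

/-- The heat semigroup on the line at time `s`. -/
noncomputable def heatFlow (s : ℝ) (f : ℝ → ℝ) (x : ℝ) : ℝ :=
  ∫ z, f (x + Real.sqrt s * z) ∂stdGauss

lemma map_sqrt_mul_stdGauss {s : ℝ} (hs : 0 ≤ s) :
    stdGauss.map (fun z => Real.sqrt s * z) = gaussianReal 0 s.toNNReal := by
  unfold stdGauss
  rw [gaussianReal_map_const_mul]
  congr 1
  · simp
  · ext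
    rw [Real.coe_toNNReal _ hs, mul_one]
    exact Real.sq_sqrt hs

lemma heatFlow_eq_integral_gaussianReal {s : ℝ} (hs : 0 ≤ s) {f : ℝ → ℝ} (hf : Measurable f)
    (x : ℝ) : heatFlow s f x = ∫ u, f (x + u) ∂gaussianReal 0 s.toNNReal := by
  have hfx : Measurable (fun u => f (x + u)) := hf.comp (measurable_const_add x)
  rw [← map_sqrt_mul_stdGauss hs, integral_map (by fun_prop) hfx.aestronglyMeasurable]
  rfl

/-- The semigroup property of the heat flow. -/
lemma heatFlow_heatFlow {a s : ℝ} (ha : 0 ≤ a) (hs : 0 ≤ s) {f : ℝ → ℝ} (hf : Measurable f)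
    (hm : Measurable (heatFlow s f))
    (hfi : ∀ x, Integrable (fun z => f (x + Real.sqrt (s + a) * z)) stdGauss) (x : ℝ) :
    heatFlow a (heatFlow s f) x = heatFlow (s + a) f x := by
  rw [heatFlow_eq_integral_gaussianReal ha hm,
    heatFlow_eq_integral_gaussianReal (add_nonneg hs ha) hf]
  simp_rw [heatFlow_eq_integral_gaussianReal hs hf]
  have hconv : gaussianReal 0 (s + a).toNNReal
      = (gaussianReal 0 a.toNNReal) ∗ (gaussianReal 0 s.toNNReal) := by
    rw [gaussianReal_conv_gaussianReal, ← Real.toNNReal_add ha hs, add_comm s, zero_add]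
  have hfx : Measurable (fun u => f (x + u)) := hf.comp (measurable_const_add x)
  have hint : Integrable (fun u => f (x + u)) (gaussianReal 0 (s + a).toNNReal) := by
    rw [← map_sqrt_mul_stdGauss (add_nonneg hs ha), integrable_map_measure
      hfx.aestronglyMeasurable (by fun_prop)]
    exact hfi x
  rw [hconv] at hint ⊢
  rw [integral_conv hint]
  simp_rw [add_assoc]

/-- A monotone, nonpositive function with at most quadratic decay. -/
structure IsTame (g : ℝ → ℝ) : Prop where
  mono : Monotone g
  nonpos : ∀ x, g x ≤ 0
  lower : ∃ a b : ℝ, 0 ≤ b ∧ ∀ x, -(a + b * x ^ 2) ≤ g x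

lemma integrable_sq_stdGauss : Integrable (fun z : ℝ => z ^ 2) stdGauss :=
  (memLp_id_gaussianReal 2).integrable_sq

lemma IsTame.exists_lower_affine {g : ℝ → ℝ} (hg : IsTame g) (c : ℝ) :
    ∃ a b : ℝ, 0 ≤ b ∧ ∀ x z, -(a + b * x ^ 2) - b * c ^ 2 * z ^ 2 ≤ g (x + c * z) := by
  obtain ⟨a, b, hb, h⟩ := hg.lower
  refine ⟨a, 2 * b, by positivity, fun x z => le_trans ?_ (h _)⟩
  nlinarith [mul_nonneg hb (sq_nonneg (x - c * z))]

lemma IsTame.integrable {g : ℝ → ℝ} (hg : IsTame g) (c x : ℝ) :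
    Integrable (fun z => g (x + c * z)) stdGauss := by
  obtain ⟨a, b, hb, h⟩ := hg.exists_lower_affine c
  refine Integrable.mono' (g := fun z => (a + b * x ^ 2) + b * c ^ 2 * z ^ 2)
    ((integrable_const _).add (integrable_sq_stdGauss.const_mul _))
    (hg.mono.measurable.comp (by fun_prop)).aestronglyMeasurable
    (Filter.Eventually.of_forall fun z => ?_)
  rw [Real.norm_eq_abs, abs_of_nonpos (hg.nonpos _)]
  linarith [h x z]

lemma IsTame.integrable_exp {g : ℝ → ℝ} (hg : IsTame g) {m : ℝ} (hm : 0 ≤ m) (c x : ℝ) :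
    Integrable (fun z => Real.exp (m * g (x + c * z))) stdGauss := by
  have hmeas : Measurable (fun z => g (x + c * z)) := hg.mono.measurable.comp (by fun_prop)
  refine Integrable.mono' (g := fun _ => (1 : ℝ)) (integrable_const _)
    (hmeas.const_mul m).exp.aestronglyMeasurable (Filter.Eventually.of_forall fun z => ?_)
  rw [Real.norm_eq_abs, abs_of_pos (Real.exp_pos _), Real.exp_le_one_iff]
  exact mul_nonpos_of_nonneg_of_nonpos hm (hg.nonpos _)

lemma IsTame.coleHopf {g : ℝ → ℝ} (hg : IsTame g) (m s : ℝ) : IsTame (coleHopf m s g) := by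
  unfold _root_.coleHopf
  split_ifs with hm
  · have hi := hg.integrable_exp hm.le (Real.sqrt s)
    refine ⟨fun x y hxy => ?_, fun x => ?_, ?_⟩
    · refine mul_le_mul_of_nonneg_left (Real.log_le_log (integral_exp_pos (hi x))
        (integral_mono (hi x) (hi y) fun z => ?_)) (by positivity)
      exact Real.exp_le_exp.2 (mul_le_mul_of_nonneg_left (hg.mono (by linarith)) hm.le)
    · refine mul_nonpos_of_nonneg_of_nonpos (by positivity)
        (Real.log_nonpos (integral_exp_pos (hi x)).le ?_)
      calc _ ≤ ∫ _, (1 : ℝ) ∂stdGauss := integral_mono (hi x) (integrable_const _) fun z =>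
            Real.exp_le_one_iff.2 (mul_nonpos_of_nonneg_of_nonpos hm.le (hg.nonpos _))
        _ = 1 := by simp
    · obtain ⟨a, b, hb, h⟩ := hg.exists_lower_affine (Real.sqrt s)
      set c := ∫ z, Real.exp (-(m * b * Real.sqrt s ^ 2 * z ^ 2)) ∂stdGauss
      have hci : Integrable (fun z => Real.exp (-(m * b * Real.sqrt s ^ 2 * z ^ 2))) stdGauss := by
        refine Integrable.mono' (g := fun _ => (1 : ℝ)) (integrable_const _)
          (by fun_prop) (Filter.Eventually.of_forall fun z => ?_)
        rw [Real.norm_eq_abs, abs_of_pos (Real.exp_pos _), Real.exp_le_one_iff]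
        exact neg_nonpos.2 (by positivity)
      have hc : 0 < c := integral_exp_pos hci
      refine ⟨a - Real.log c / m, b, hb, fun x => ?_⟩
      have hle : Real.exp (-(m * (a + b * x ^ 2))) * c
          ≤ ∫ z, Real.exp (m * g (x + Real.sqrt s * z)) ∂stdGauss := by
        rw [← integral_const_mul]
        refine integral_mono (hci.const_mul _) (hi x) fun z => ?_
        simp only
        rw [← Real.exp_add, Real.exp_le_exp]
        calc _ = m * (-(a + b * x ^ 2) - b * Real.sqrt s ^ 2 * z ^ 2) := by ring
          _ ≤ _ := mul_le_mul_of_nonneg_left (h x z) hm.le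
      calc -(a - Real.log c / m + b * x ^ 2)
          = 1 / m * Real.log (Real.exp (-(m * (a + b * x ^ 2))) * c) := by
            rw [Real.log_mul (Real.exp_pos _).ne' hc.ne', Real.log_exp]
            field_simp
            ring
        _ ≤ _ := mul_le_mul_of_nonneg_left
            (Real.log_le_log (mul_pos (Real.exp_pos _) hc) hle) (by positivity)
  · have hi := hg.integrable (Real.sqrt s)
    refine ⟨fun x y hxy => ?_, fun x => integral_nonpos fun z => hg.nonpos _, ?_⟩
    · exact integral_mono (hi x) (hi y) fun z => hg.mono (by linarith)
    · obtain ⟨a, b, hb, h⟩ := hg.exists_lower_affine (Real.sqrt s)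
      refine ⟨a + b * Real.sqrt s ^ 2 * ∫ z, z ^ 2 ∂stdGauss, b, hb, fun x => ?_⟩
      calc _ = ∫ z, (-(a + b * x ^ 2) - b * Real.sqrt s ^ 2 * z ^ 2) ∂stdGauss := by
            rw [integral_sub (integrable_const _) (integrable_sq_stdGauss.const_mul _),
              integral_const_mul, integral_const]
            simp only [probReal_univ, smul_eq_mul]
            ring
        _ ≤ _ := integral_mono
            ((integrable_const _).sub (integrable_sq_stdGauss.const_mul _)) (hi x) (h x)

/-- A Cole–Hopf step with exponent `m ≤ 1` propagates a bound on the increments of the boundary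
value: if `exp` of the increments is bounded by an antitone `U`, then `exp` of the increments
of the solution is bounded by the heat flow of `U`. -/
lemma coleHopf_add_le {g U : ℝ → ℝ} {m s h : ℝ} (hg : IsTame g) (hm : m ≤ 1)
    (hU : Antitone U) (hU0 : ∀ x, 0 < U x)
    (hUi : ∀ x, Integrable (fun z => U (x + Real.sqrt s * z)) stdGauss)
    (hgU : ∀ x, g (x + h) ≤ g x + Real.log (U x)) (x : ℝ) :
    coleHopf m s g (x + h) ≤ coleHopf m s g x + Real.log (heatFlow s U x) := by
  set V : ℝ → ℝ := fun z => U (x + Real.sqrt s * z) with hVdef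
  have hV0 : ∀ z, 0 < V z := fun z => hU0 _
  have hVi : Integrable V stdGauss := hUi x
  have hVanti : Antitone V := fun y z hyz => hU (by gcongr)
  have hEV : 0 < ∫ z, V z ∂stdGauss := by
    rw [integral_pos_iff_support_of_nonneg (fun z => (hV0 z).le) hVi,
      (Set.eq_univ_of_forall fun z => (hV0 z).ne' : Function.support V = Set.univ)]
    simp
  have hinc : ∀ z, g (x + h + Real.sqrt s * z) ≤ g (x + Real.sqrt s * z) + Real.log (V z) := by
    intro z
    rw [add_right_comm]
    exact hgU _
  change _ ≤ _ + Real.log (∫ z, V z ∂stdGauss)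
  unfold coleHopf
  split_ifs with hm0
  · set w : ℝ → ℝ := fun z => Real.exp (m * g (x + Real.sqrt s * z)) with hw
    have hwi : Integrable w stdGauss := hg.integrable_exp hm0.le _ x
    have hw0 : 0 < ∫ z, w z ∂stdGauss := integral_exp_pos hwi
    have hwmono : Monotone w := fun y z hyz =>
      Real.exp_le_exp.2 (mul_le_mul_of_nonneg_left (hg.mono (by gcongr)) hm0.le)
    have hw1 : ∀ z, w z ≤ 1 := fun z =>
      Real.exp_le_one_iff.2 (mul_nonpos_of_nonneg_of_nonpos hm0.le (hg.nonpos _))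
    have hwpos : ∀ z, 0 < w z := fun z => Real.exp_pos _
    have hwVi : Integrable (fun z => w z * V z) stdGauss :=
      Integrable.mono' hVi (hwi.aestronglyMeasurable.mul hVi.aestronglyMeasurable)
        (Filter.Eventually.of_forall fun z => by
          rw [Real.norm_eq_abs, abs_of_pos (mul_pos (hwpos z) (hV0 z))]
          exact mul_le_of_le_one_left (hV0 z).le (hw1 z))
    have hwV0 : 0 < ∫ z, w z * V z ∂stdGauss := by
      rw [integral_pos_iff_support_of_nonneg (fun z => (mul_pos (hwpos z) (hV0 z)).le) hwVi,
        (Set.eq_univ_of_forall fun z => (mul_pos (hwpos z) (hV0 z)).ne' :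
          Function.support (fun z => w z * V z) = Set.univ)]
      simp
    have hJ := integral_mul_rpow_le hm0.le hm (fun z => (hwpos z).le) hV0 hwi hwVi hw0 hwV0
    have hC := integral_mul_le_of_monotone_antitone hwmono hVanti hwi hVi hwVi
    have hpow : ∀ z, w z * V z ^ m
        = Real.exp (m * (g (x + Real.sqrt s * z) + Real.log (V z))) := by
      intro z
      rw [mul_add, Real.exp_add, Real.rpow_def_of_pos (hV0 z), mul_comm (Real.log _)]
    have hwVm : Integrable (fun z => w z * V z ^ m) stdGauss := by
      refine Integrable.mono' (hwi.add hwVi) (hwi.aestronglyMeasurable.mul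
        (hVi.aestronglyMeasurable.aemeasurable.pow_const m).aestronglyMeasurable)
        (Filter.Eventually.of_forall fun z => ?_)
      rw [Real.norm_eq_abs, abs_of_pos (mul_pos (hwpos z) (Real.rpow_pos_of_pos (hV0 z) m)),
        Pi.add_apply, ← mul_one_add]
      refine mul_le_mul_of_nonneg_left ?_ (hwpos z).le
      calc V z ^ m ≤ (1 + V z) ^ m :=
            Real.rpow_le_rpow (hV0 z).le (by linarith) hm0.le
        _ ≤ (1 + V z) ^ (1 : ℝ) :=
            Real.rpow_le_rpow_of_exponent_le (by linarith [hV0 z]) hm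
        _ = 1 + V z := Real.rpow_one _
    have hmain : ∫ z, Real.exp (m * g (x + h + Real.sqrt s * z)) ∂stdGauss
        ≤ (∫ z, w z ∂stdGauss) * (∫ z, V z ∂stdGauss) ^ m := by
      calc _ ≤ ∫ z, w z * V z ^ m ∂stdGauss := by
            refine integral_mono (hg.integrable_exp hm0.le _ _) hwVm fun z => ?_
            simp only [hpow]
            exact Real.exp_le_exp.2 (mul_le_mul_of_nonneg_left (hinc z) hm0.le)
        _ ≤ _ := hJ
        _ ≤ _ := by
            refine mul_le_mul_of_nonneg_left (Real.rpow_le_rpow (by positivity) ?_ hm0.le) hw0.le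
            rw [div_le_iff₀ hw0, mul_comm]
            exact hC
    have hlog := Real.log_le_log (integral_exp_pos (hg.integrable_exp hm0.le _ _)) hmain
    rw [Real.log_mul hw0.ne' (Real.rpow_pos_of_pos hEV m).ne', Real.log_rpow hEV] at hlog
    calc _ ≤ 1 / m * (Real.log (∫ z, w z ∂stdGauss) + m * Real.log (∫ z, V z ∂stdGauss)) :=
          mul_le_mul_of_nonneg_left hlog (by positivity)
      _ = _ := by rw [mul_add, ← mul_assoc, one_div_mul_cancel hm0.ne', one_mul]
  · set E := ∫ z, V z ∂stdGauss with hE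
    have htan : ∀ z, g (x + h + Real.sqrt s * z)
        ≤ g (x + Real.sqrt s * z) + (Real.log E - 1 + V z / E) := by
      intro z
      have h1 := Real.log_le_sub_one_of_pos (div_pos (hV0 z) hEV)
      rw [Real.log_div (hV0 z).ne' hEV.ne'] at h1
      linarith [hinc z]
    have hri : Integrable (fun z => Real.log E - 1 + V z / E) stdGauss :=
      (integrable_const _).add (hVi.div_const _)
    calc _ ≤ ∫ z, (g (x + Real.sqrt s * z) + (Real.log E - 1 + V z / E)) ∂stdGauss :=
          integral_mono (hg.integrable _ _) ((hg.integrable _ _).add hri) htan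
      _ = _ := by
          rw [integral_add (hg.integrable _ _) hri,
            integral_add (integrable_const _) (hVi.div_const _), integral_div, ← hE,
            div_self hEV.ne']
          simp

lemma heatFlow_zero (f : ℝ → ℝ) : heatFlow 0 f = f := by
  ext x
  simp [heatFlow]

/-- The bound on the exponential of the increments of step `r * h` of the terminal value
`x ↦ log 𝒩((κ - x) / r)`. -/
noncomputable def expBarrier (κ r h x : ℝ) : ℝ := Real.exp (h * (2 + max ((κ - x) / r) 0))

section Barrier

variable {κ r h : ℝ}

lemma expBarrier_pos (κ r h x : ℝ) : 0 < expBarrier κ r h x := Real.exp_pos _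

lemma expBarrier_antitone (hr : 0 < r) (hh : 0 ≤ h) : Antitone (expBarrier κ r h) := by
  intro x y hxy
  unfold expBarrier
  gcongr

lemma expBarrier_add_le (hr : 0 < r) (hh : 0 ≤ h) {c : ℝ} (hc : 0 ≤ c) (x z : ℝ) :
    expBarrier κ r h (x + c * z) ≤ expBarrier κ r h x * Real.exp (h * c / r * |z|) := by
  unfold expBarrier
  rw [← Real.exp_add, Real.exp_le_exp, show h * (2 + max ((κ - x) / r) 0) + h * c / r * |z|
    = h * (2 + (max ((κ - x) / r) 0 + c / r * |z|)) by ring]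
  have hcz : 0 ≤ c / r * |z| := by positivity
  have hz : -(c / r * z) ≤ c / r * |z| := by
    rw [← mul_neg]
    exact mul_le_mul_of_nonneg_left (neg_le_abs z) (by positivity)
  have e : (κ - (x + c * z)) / r = (κ - x) / r + -(c / r * z) := by field_simp; ring
  refine mul_le_mul_of_nonneg_left (add_le_add_right (max_le ?_ ?_) 2) hh
  · rw [e]
    exact add_le_add (le_max_left _ _) hz
  · exact add_nonneg (le_max_right _ _) hcz

lemma integrable_of_le_expBarrier (hr : 0 < r) (hh : 0 ≤ h) {U : ℝ → ℝ} (hU : Antitone U)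
    (hU0 : ∀ x, 0 < U x) {K : ℝ} (hUK : ∀ x, U x ≤ expBarrier κ r h x * K) {c : ℝ} (hc : 0 ≤ c)
    (x : ℝ) : Integrable (fun z => U (x + c * z)) stdGauss := by
  have hK : 0 ≤ K := nonneg_of_mul_nonneg_right ((hU0 0).le.trans (hUK 0)) (expBarrier_pos κ r h 0)
  refine Integrable.mono' (((integrable_exp_mul_abs_stdGauss (h * c / r)).const_mul
    (expBarrier κ r h x)).mul_const K)
    (hU.measurable.comp (by fun_prop)).aestronglyMeasurable
    (Filter.Eventually.of_forall fun z => ?_)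
  rw [Real.norm_eq_abs, abs_of_pos (hU0 _)]
  exact (hUK _).trans (mul_le_mul_of_nonneg_right (expBarrier_add_le hr hh hc x z) hK)

lemma integrable_expBarrier (hr : 0 < r) (hh : 0 ≤ h) (s x : ℝ) :
    Integrable (fun z => expBarrier κ r h (x + Real.sqrt s * z)) stdGauss :=
  integrable_of_le_expBarrier hr hh (expBarrier_antitone hr hh) (expBarrier_pos κ r h)
    (K := 1) (fun _ => (mul_one _).ge) (Real.sqrt_nonneg s) x

lemma heatFlow_expBarrier_antitone (hr : 0 < r) (hh : 0 ≤ h) (s : ℝ) :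
    Antitone (heatFlow s (expBarrier κ r h)) := fun x y hxy =>
  integral_mono (integrable_expBarrier hr hh s y) (integrable_expBarrier hr hh s x) fun z =>
    expBarrier_antitone hr hh (by linarith)

lemma heatFlow_expBarrier_pos (hr : 0 < r) (hh : 0 ≤ h) (s x : ℝ) :
    0 < heatFlow s (expBarrier κ r h) x :=
  integral_exp_pos (integrable_expBarrier hr hh s x)

lemma heatFlow_expBarrier_le (hr : 0 < r) (hh : 0 ≤ h) (s x : ℝ) :
    heatFlow s (expBarrier κ r h) x
      ≤ expBarrier κ r h x * ∫ z, Real.exp (h * Real.sqrt s / r * |z|) ∂stdGauss := by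
  rw [← integral_const_mul]
  exact integral_mono (integrable_expBarrier hr hh s x)
    ((integrable_exp_mul_abs_stdGauss _).const_mul _)
    (expBarrier_add_le hr hh (Real.sqrt_nonneg s) x)

lemma log_heatFlow_expBarrier_le (hr : 0 < r) (hh : 0 ≤ h) (h1 : h ≤ 1) {s : ℝ} (hs : s ≤ 1)
    (x : ℝ) : Real.log (heatFlow s (expBarrier κ r h) x)
      ≤ h * (2 + max ((κ - x) / r) 0
        + Real.log (∫ z, Real.exp (1 / r * |z|) ∂stdGauss)) := by
  have hpos : 0 < ∫ z, Real.exp (1 / r * |z|) ∂stdGauss :=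
    integral_exp_pos (integrable_exp_mul_abs_stdGauss _)
  have hJ := integral_mul_rpow_le (μ := stdGauss) (w := fun _ => 1)
    (V := fun z => Real.exp (1 / r * |z|)) hh h1 (fun _ => zero_le_one) (fun _ => Real.exp_pos _)
    (integrable_const _) (by simpa using integrable_exp_mul_abs_stdGauss (1 / r))
    (by simp) (by simpa using hpos)
  simp only [one_mul, integral_const, probReal_univ, smul_eq_mul, mul_one, div_one,
    ← Real.exp_mul] at hJ
  have hle : ∫ z, Real.exp (h * Real.sqrt s / r * |z|) ∂stdGauss
      ≤ (∫ z, Real.exp (1 / r * |z|) ∂stdGauss) ^ h := by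
    refine le_trans ?_ hJ
    have e : ∀ z : ℝ, 1 / r * |z| * h = h / r * |z| := fun z => by ring
    simp only [e]
    refine integral_mono (integrable_exp_mul_abs_stdGauss _) (integrable_exp_mul_abs_stdGauss _)
      fun z => ?_
    have : Real.sqrt s ≤ 1 := Real.sqrt_le_one.2 hs
    have : h * Real.sqrt s ≤ h := mul_le_of_le_one_right hh this
    simp only
    gcongr
  calc _ ≤ Real.log (expBarrier κ r h x * (∫ z, Real.exp (1 / r * |z|) ∂stdGauss) ^ h) :=
        Real.log_le_log (heatFlow_expBarrier_pos hr hh s x)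
          ((heatFlow_expBarrier_le hr hh s x).trans
            (mul_le_mul_of_nonneg_left hle (expBarrier_pos κ r h x).le))
    _ = _ := by
        rw [Real.log_mul (expBarrier_pos κ r h x).ne' (Real.rpow_pos_of_pos hpos h).ne',
          Real.log_rpow hpos, expBarrier, Real.log_exp]
        ring

end Barrier

/-- A tame function whose small increments are controlled by the heat flow at time `s` of the
barrier. -/
structure HasIncrementBound (κ r s : ℝ) (g : ℝ → ℝ) : Prop where
  tame : IsTame g
  incr : ∀ h, 0 < h → h ≤ 1 → ∀ x,
    g (x + r * h) ≤ g x + Real.log (heatFlow s (expBarrier κ r h) x)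

lemma HasIncrementBound.coleHopf {κ r s m a : ℝ} {g : ℝ → ℝ} (hr : 0 < r) (hs : 0 ≤ s)
    (ha : 0 ≤ a) (hm : m ≤ 1) (hg : HasIncrementBound κ r s g) :
    HasIncrementBound κ r (s + a) (coleHopf m a g) := by
  refine ⟨hg.tame.coleHopf m a, fun h h0 h1 x => ?_⟩
  have hanti := heatFlow_expBarrier_antitone (κ := κ) hr h0.le s
  rw [← heatFlow_heatFlow ha hs (expBarrier_antitone hr h0.le).measurable hanti.measurable
    (integrable_expBarrier hr h0.le (s + a))]
  exact coleHopf_add_le hg.tame hm hanti (heatFlow_expBarrier_pos hr h0.le s)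
    (integrable_of_le_expBarrier hr h0.le hanti (heatFlow_expBarrier_pos hr h0.le s)
      (heatFlow_expBarrier_le hr h0.le s) (Real.sqrt_nonneg a)) (hg.incr h h0 h1) x

lemma isTame_log_gaussTail {κ r : ℝ} (hr : 0 < r) :
    IsTame fun x => Real.log (gaussTail ((κ - x) / r)) := by
  refine ⟨fun x y hxy => Real.log_le_log (gaussTail_pos _) (gaussTail_antitone (by gcongr)),
    fun x => Real.log_nonpos (gaussTail_pos _).le (gaussTail_le_one _), ?_⟩
  obtain ⟨c, hc, h⟩ := exists_le_gaussTail
  refine ⟨1 / 2 - Real.log c + 2 * (κ / r) ^ 2, 2 * (1 / r) ^ 2, by positivity, fun x => ?_⟩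
  have h1 := Real.log_le_log (mul_pos hc (Real.exp_pos _)) (h ((κ - x) / r))
  rw [Real.log_mul hc.ne' (Real.exp_pos _).ne', Real.log_exp] at h1
  refine le_trans ?_ h1
  set v := (κ - x) / r with hv
  have h2 : v = κ / r - 1 / r * x := by rw [hv]; ring
  have h3 : |v| ≤ 1 / 2 + v ^ 2 / 2 := by nlinarith [sq_nonneg (|v| - 1), sq_abs v]
  have h4 : v ^ 2 ≤ 2 * (κ / r) ^ 2 + 2 * (1 / r) ^ 2 * x ^ 2 := by
    rw [h2]; nlinarith [sq_nonneg (κ / r + 1 / r * x)]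
  linarith

lemma hasIncrementBound_log_gaussTail {κ r : ℝ} (hr : 0 < r) :
    HasIncrementBound κ r 0 fun x => Real.log (gaussTail ((κ - x) / r)) := by
  refine ⟨isTame_log_gaussTail hr, fun h h0 h1 x => ?_⟩
  rw [heatFlow_zero, expBarrier, Real.log_exp,
    show (κ - (x + r * h)) / r = (κ - x) / r - h by field_simp; ring]
  exact log_gaussTail_sub_le h0 h1 _

lemma deriv_le_of_forall_add_le {f : ℝ → ℝ} {x r M : ℝ} (hr : 0 < r) (hM : 0 ≤ M)
    (h : ∀ t, 0 < t → t ≤ r → f (x + t) ≤ f x + t * M) : deriv f x ≤ M := by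
  by_cases hf : DifferentiableAt ℝ f x
  · refine le_of_tendsto hf.hasDerivAt.tendsto_slope_zero_right ?_
    filter_upwards [Ioc_mem_nhdsGT hr] with t ht
    rw [smul_eq_mul, inv_mul_le_iff₀ ht.1]
    linarith [h t ht.1 ht.2]
  · rw [deriv_zero_of_not_differentiableAt hf]
    exact hM

lemma HasIncrementBound.deriv_le {κ r s : ℝ} {g : ℝ → ℝ} (hr : 0 < r) (hs : s ≤ 1)
    (hg : HasIncrementBound κ r s g) (x : ℝ) :
    deriv g x ≤ (2 + max ((κ - x) / r) 0
      + Real.log (∫ z, Real.exp (1 / r * |z|) ∂stdGauss)) / r := by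
  have hlog : 0 ≤ Real.log (∫ z, Real.exp (1 / r * |z|) ∂stdGauss) := by
    refine Real.log_nonneg ?_
    calc (1 : ℝ) = ∫ _, (1 : ℝ) ∂stdGauss := by simp
      _ ≤ _ := integral_mono (integrable_const _) (integrable_exp_mul_abs_stdGauss _) fun z =>
          Real.one_le_exp_iff.2 (by positivity)
  refine deriv_le_of_forall_add_le hr (by positivity) fun t ht htr => ?_
  have h1 := hg.incr (t / r) (by positivity) ((div_le_one hr).2 htr) x
  have h2 := log_heatFlow_expBarrier_le (κ := κ) hr (by positivity : 0 ≤ t / r)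
    ((div_le_one hr).2 htr) hs x
  rw [mul_div_cancel₀ _ hr.ne'] at h1
  rw [mul_div_assoc', mul_div_right_comm]
  linarith

namespace StepFn

lemma m_le_one (γ : StepFn) {i : ℕ} (hi : i ≤ γ.n) : γ.m i ≤ 1 := by
  induction hi using Nat.decreasingInduction with
  | self => exact γ.m_last.le
  | of_succ k hk ih => exact (γ.m_mono k hk).trans ih

lemma q_le_qbar (γ : StepFn) {i : ℕ} (hi : i ≤ γ.n) : γ.q i ≤ γ.qbar := by
  induction hi using Nat.decreasingInduction with
  | self => exact le_rfl
  | of_succ k hk ih => exact (γ.q_lt k hk.le).le.trans ih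

lemma qbar_lt_one (γ : StepFn) : γ.qbar < 1 := by
  have := γ.q_lt γ.n le_rfl
  rwa [γ.q_last] at this

lemma hasIncrementBound_PhiAux_succ (γ : StepFn) (κ : ℝ) {j : ℕ}
    (h : HasIncrementBound κ (Real.sqrt (1 - γ.qbar)) (γ.qbar - γ.q (γ.n - j))
      (γ.PhiAux κ j (γ.q (γ.n - j)))) {t : ℝ} (ht : t ≤ γ.q (γ.n - j)) :
    HasIncrementBound κ (Real.sqrt (1 - γ.qbar)) (γ.qbar - t) (γ.PhiAux κ (j + 1) t) := by
  rw [show γ.qbar - t = γ.qbar - γ.q (γ.n - j) + (γ.q (γ.n - j) - t) by ring]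
  exact h.coleHopf (Real.sqrt_pos.2 (sub_pos.2 γ.qbar_lt_one))
    (sub_nonneg.2 (γ.q_le_qbar (Nat.sub_le _ _))) (sub_nonneg.2 ht)
    (γ.m_le_one (Nat.sub_le _ _))

lemma hasIncrementBound_PhiAux (γ : StepFn) (κ : ℝ) {j : ℕ} (hj : j ≤ γ.n) :
    HasIncrementBound κ (Real.sqrt (1 - γ.qbar)) (γ.qbar - γ.q (γ.n - j))
      (γ.PhiAux κ j (γ.q (γ.n - j))) := by
  induction j with
  | zero =>
    rw [Nat.sub_zero, ← qbar, sub_self]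
    exact hasIncrementBound_log_gaussTail (Real.sqrt_pos.2 (sub_pos.2 γ.qbar_lt_one))
  | succ j ih =>
    refine γ.hasIncrementBound_PhiAux_succ κ (ih (by omega)) ?_
    have h := γ.q_lt (γ.n - (j + 1)) (Nat.sub_le _ _)
    rw [show γ.n - (j + 1) + 1 = γ.n - j by omega] at h
    exact h.le

lemma hasIncrementBound_Phi (γ : StepFn) (κ : ℝ) {t : ℝ} (ht : t ∈ Set.Icc 0 γ.qbar) :
    HasIncrementBound κ (Real.sqrt (1 - γ.qbar)) (γ.qbar - t) (γ.Phi κ t) := by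
  classical
  unfold Phi
  set i := Nat.findGreatest (fun i => γ.q i ≤ t) γ.n with hi
  have hin : i ≤ γ.n := Nat.findGreatest_le _
  rcases hin.eq_or_lt with h | h
  · have hq : γ.q i ≤ t := Nat.findGreatest_spec (P := fun i => γ.q i ≤ t) (Nat.zero_le _)
      (by simpa [γ.q_zero] using ht.1)
    have ht' : t = γ.q (γ.n - 0) := by
      rw [h] at hq
      exact le_antisymm ht.2 hq
    rw [h, Nat.sub_self, ht']
    exact γ.hasIncrementBound_PhiAux κ (Nat.zero_le _)
  · have hq : t < γ.q (i + 1) := not_le.1 (Nat.findGreatest_is_greatest (Nat.lt_succ_self i) h)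
    rw [show γ.n - i = γ.n - (i + 1) + 1 by omega]
    refine γ.hasIncrementBound_PhiAux_succ κ (γ.hasIncrementBound_PhiAux κ (by omega)) ?_
    rw [show γ.n - (γ.n - (i + 1)) = i + 1 by omega]
    exact hq.le

end StepFn

/-- upper bound in Proposition 4.1, Eq. (4.8): for `γ ∈ SF⁺` with
`q̄ = q̄(γ)` there is a constant `C > 0` depending only on `κ` and `q̄` such that
`∂ₓΦ_γ(t,x) ≤ C(1 + max((κ−x)/√(1−q̄), 1))` for all `(t,x) ∈ [0,q̄] × ℝ`, uniformly over
all `γ' ∈ SF⁺` with the same `q̄`. -/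
theorem statement_2 (κ : ℝ) (γ : StepFn) :
    ∃ C > (0 : ℝ), ∀ γ' : StepFn, γ'.qbar = γ.qbar →
      ∀ t ∈ Set.Icc (0 : ℝ) γ.qbar, ∀ x : ℝ,
        deriv (fun y => γ'.Phi κ t y) x ≤
          C * (1 + max ((κ - x) / Real.sqrt (1 - γ.qbar)) 1) := by
  set r := Real.sqrt (1 - γ.qbar) with hrdef
  have hr : 0 < r := Real.sqrt_pos.2 (sub_pos.2 γ.qbar_lt_one)
  set A := |Real.log (∫ z, Real.exp (1 / r * |z|) ∂stdGauss)| with hA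
  refine ⟨(2 + A) / r, by positivity, fun γ' hγ t ht x => ?_⟩
  have hΦ := γ'.hasIncrementBound_Phi κ (hγ.symm ▸ ht)
  rw [hγ, ← hrdef] at hΦ
  have hd := hΦ.deriv_le hr (by linarith [ht.1, γ.qbar_lt_one]) x
  refine hd.trans ?_
  rw [div_mul_eq_mul_div]
  refine div_le_div_of_nonneg_right ?_ hr.le
  have h1 : max ((κ - x) / r) 0 ≤ max ((κ - x) / r) 1 := max_le_max_left _ zero_le_one
  have h2 : (1 : ℝ) ≤ max ((κ - x) / r) 1 := le_max_right _ _
  have h3 : 0 ≤ A := abs_nonneg _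
  have h4 := le_abs_self (Real.log (∫ z, Real.exp (1 / r * |z|) ∂stdGauss))
  nlinarith
end
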